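/- arXiv:2410.06902 — 4 statements merged into one kernel-verified Lean document; each statement's English description precedes it below -/
import Mathlib

section
/- The map X ↦ (iX − I)(iX + I)⁻¹, applied after entrywise complexification, is a bijection from the set of real symmetric s×s matrices onto the set of complex unitary s×s matrices A such that Aᵀ = A and A − I is invertible. -/
open Matrix

namespace Matrix

theorem isHermitian_map_ofReal {n : Type*} {X : Matrix n n ℝ} (hX : Xᵀ = X) :
    (X.map Complex.ofReal).IsHermitian := by
  ext i j
  simpa using congrFun (congrFun hX i) j

/-- A complex matrix that is both Hermitian and symmetric is real. -/
theorem IsHermitian.map_ofReal_map_re {n : Type*} {H : Matrix n n ℂ} (hH : H.IsHermitian)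
    (hT : Hᵀ = H) :
    (H.map Complex.re).map Complex.ofReal = H := by
  ext i j
  have h1 : star (H j i) = H i j := hH.apply i j
  have h2 : H j i = H i j := congrFun (congrFun hT i) j
  rw [h2] at h1
  exact Complex.conj_eq_iff_re.1 h1

variable {n : Type*} [Fintype n] [DecidableEq n]

open scoped ComplexOrder in
/-- If `X` is Hermitian then `iX + 1` is invertible. -/
theorem IsHermitian.isUnit_I_smul_add_one {X : Matrix n n ℂ} (hX : X.IsHermitian) :
    IsUnit (Complex.I • X + 1) := by
  have hpos : (1 + Xᴴ * X).PosDef :=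
    PosDef.one.add_posSemidef (posSemidef_conjTranspose_mul_self X)
  have hfac : (1 - Complex.I • X) * (Complex.I • X + 1) = 1 + Xᴴ * X := by
    rw [hX.eq, sub_mul, mul_add (Complex.I • X), smul_mul_smul_comm, Complex.I_mul_I, one_mul,
      mul_one]
    module
  have hu := hpos.isUnit
  rw [← hfac, isUnit_iff_isUnit_det, det_mul] at hu
  exact (isUnit_iff_isUnit_det _).2 (isUnit_of_mul_isUnit_right hu)

theorem sub_one_mul_inv_add_one {Y : Matrix n n ℂ} (hY : IsUnit (Y + 1)) :
    (Y - 1) * (Y + 1)⁻¹ = 1 - (2 : ℂ) • (Y + 1)⁻¹ := by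
  have h : (Y + 1) * (Y + 1)⁻¹ = 1 := mul_nonsing_inv _ ((isUnit_iff_isUnit_det _).1 hY)
  calc (Y - 1) * (Y + 1)⁻¹ = (Y + 1) * (Y + 1)⁻¹ - (2 : ℂ) • (Y + 1)⁻¹ := by
        rw [two_smul]; noncomm_ring
    _ = _ := by rw [h]

/-- The Cayley transform of a skew-Hermitian matrix is unitary. -/
theorem conjTranspose_one_sub_two_smul_inv_mul_self {Y : Matrix n n ℂ} (hY : IsUnit (Y + 1))
    (hskew : Yᴴ = -Y) :
    (1 - (2 : ℂ) • (Y + 1)⁻¹)ᴴ * (1 - (2 : ℂ) • (Y + 1)⁻¹) = 1 := by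
  have h : (Y + 1) * (Y + 1)⁻¹ = 1 := mul_nonsing_inv _ ((isUnit_iff_isUnit_det _).1 hY)
  set B := (Y + 1)⁻¹
  have h' : Bᴴ * (1 - Y) = 1 := by
    have := congrArg conjTranspose h
    rw [conjTranspose_mul, conjTranspose_add, hskew, conjTranspose_one] at this
    rwa [sub_eq_neg_add]
  have key : B + Bᴴ = (2 : ℂ) • (Bᴴ * B) := by
    calc B + Bᴴ = (Bᴴ * (1 - Y)) * B + Bᴴ * ((Y + 1) * B) := by rw [h, h', one_mul, mul_one]
      _ = (2 : ℂ) • (Bᴴ * B) := by rw [two_smul]; noncomm_ring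
  have h2 : ((2 : ℂ) • B)ᴴ = (2 : ℂ) • Bᴴ := by simp [conjTranspose_smul]
  calc _ = 1 - (2 : ℂ) • (B + Bᴴ) + (2 : ℂ) • (2 : ℂ) • (Bᴴ * B) := by
        rw [conjTranspose_sub, conjTranspose_one, h2]
        simp only [two_smul]
        noncomm_ring
    _ = 1 := by rw [key]; abel

/-- If `A` is unitary and `C` is an inverse of `A - 1`, then `C + Cᴴ = -1`. -/
theorem add_conjTranspose_eq_neg_one {A C : Matrix n n ℂ} (hA : Aᴴ * A = 1)
    (hC : (A - 1) * C = 1) : C + Cᴴ = -1 := by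
  have hC' : Cᴴ * (Aᴴ - 1) = 1 := by
    simpa [conjTranspose_mul] using congrArg conjTranspose hC
  have hsum : (Aᴴ - 1) * (A - 1) + (Aᴴ - 1) + (A - 1) = 0 := by
    have : (Aᴴ - 1) * (A - 1) + (Aᴴ - 1) + (A - 1) = Aᴴ * A - 1 := by noncomm_ring
    rw [this, hA, sub_self]
  have : 1 + C + Cᴴ = 0 := by
    calc 1 + C + Cᴴ = (Cᴴ * (Aᴴ - 1)) * ((A - 1) * C) + (Cᴴ * (Aᴴ - 1)) * C
          + Cᴴ * ((A - 1) * C) := by rw [hC, hC']; simp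
      _ = Cᴴ * ((Aᴴ - 1) * (A - 1) + (Aᴴ - 1) + (A - 1)) * C := by noncomm_ring
      _ = 0 := by rw [hsum]; simp
  rw [eq_neg_iff_add_eq_zero, ← this]
  abel

end Matrix

/-- The map `X ↦ (iX - I)(iX + I)⁻¹`, applied after entrywise complexification, is a bijection
from the set of real symmetric `s × s` matrices onto the set of complex unitary `s × s`
matrices `A` with `Aᵀ = A` and `A - I` invertible. -/
theorem cayley_transform_real_symmetric_bijOn (s : ℕ) (hs : 0 < s) :
    Set.BijOn
      (fun X : Matrix (Fin s) (Fin s) ℝ =>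
        (Complex.I • X.map Complex.ofReal - 1) * (Complex.I • X.map Complex.ofReal + 1)⁻¹)
      {X : Matrix (Fin s) (Fin s) ℝ | Xᵀ = X}
      {A : Matrix (Fin s) (Fin s) ℂ | Aᴴ * A = 1 ∧ Aᵀ = A ∧ IsUnit (A - 1)} := by
  refine ⟨fun X hX => ?_, fun X hX X' hX' h => ?_, fun A ⟨hA, hT, hu⟩ => ?_⟩
  · have hH := isHermitian_map_ofReal hX
    have hY := hH.isUnit_I_smul_add_one
    have hXT : (X.map Complex.ofReal)ᵀ = X.map Complex.ofReal := by
      rw [← transpose_map, show Xᵀ = X from hX]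
    simp only [Set.mem_ofPred_eq]
    rw [sub_one_mul_inv_add_one hY]
    refine ⟨conjTranspose_one_sub_two_smul_inv_mul_self hY ?_, ?_, ?_⟩
    · rw [conjTranspose_smul, hH.eq]
      simp
    · rw [transpose_sub, transpose_smul, transpose_nonsing_inv, transpose_add, transpose_smul,
        hXT, transpose_one]
    · have hinv := (isUnit_nonsing_inv_iff (A := Complex.I • X.map Complex.ofReal + 1)).2 hY
      rw [sub_sub_cancel_left]
      exact (hinv.smul (Units.mk0 (2 : ℂ) two_ne_zero)).neg
  · have hY := (isHermitian_map_ofReal hX).isUnit_I_smul_add_one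
    have hY' := (isHermitian_map_ofReal hX').isUnit_I_smul_add_one
    simp only at h
    rw [sub_one_mul_inv_add_one hY, sub_one_mul_inv_add_one hY'] at h
    have h1 := smul_right_injective _ (two_ne_zero (α := ℂ)) (sub_right_injective h)
    have h2 := add_right_cancel (inv_inj h1 ((isUnit_iff_isUnit_det _).1 hY))
    exact map_injective Complex.ofReal_injective
      (smul_right_injective _ Complex.I_ne_zero h2)
  · have hdet := (isUnit_iff_isUnit_det _).1 hu
    have hC : (A - 1) * (A - 1)⁻¹ = 1 := mul_nonsing_inv _ hdet
    have hCT : ((A - 1)⁻¹)ᵀ = (A - 1)⁻¹ := by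
      rw [transpose_nonsing_inv, transpose_sub, hT, transpose_one]
    have hsum := add_conjTranspose_eq_neg_one hA hC
    set C := (A - 1)⁻¹
    set H : Matrix (Fin s) (Fin s) ℂ := Complex.I • ((2 : ℂ) • C + 1) with hHdef
    have hHT : Hᵀ = H := by simp [hHdef, hCT]
    have hHH : H.IsHermitian := by
      have hCH : Cᴴ = -1 - C := eq_sub_of_add_eq' hsum
      have h2 : star (2 : ℂ) = 2 := by simp
      rw [IsHermitian, hHdef, conjTranspose_smul, conjTranspose_add, conjTranspose_smul, hCH,
        conjTranspose_one, h2]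
      simp only [RCLike.star_def, Complex.conj_I]
      module
    have hreal := hHH.map_ofReal_map_re hHT
    refine ⟨H.map Complex.re, ?_, ?_⟩
    · change (H.map Complex.re)ᵀ = _
      rw [← transpose_map, hHT]
    · simp only [hreal]
      rw [sub_one_mul_inv_add_one hHH.isUnit_I_smul_add_one]
      have hP : Complex.I • H + 1 = (-2 : ℂ) • C := by
        rw [hHdef, smul_smul, Complex.I_mul_I]
        module
      have hinv : ((-2 : ℂ) • C)⁻¹ = (-1 / 2 : ℂ) • (A - 1) := by
        refine inv_eq_left_inv ?_
        rw [smul_mul_smul_comm, hC]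
        norm_num
      rw [hP, hinv]
      module
end

section
/- Let n₁,…,n_k be positive integers and let X be a complex square matrix of size n₁+⋯+n_k, written in block form with blocks of sizes nⱼ × n_l. If X commutes with every block-diagonal matrix diag(g₁,…,g_k) in which each gⱼ is a unitary nⱼ×nⱼ matrix, then there exist complex scalars c₁,…,c_k such that X = diag(c₁·I_{n₁},…,c_k·I_{n_k}), the block-diagonal matrix whose j-th block is the scalar matrix c_j·I_{n_j}. -/
open Matrix

/-- If a complex square matrix of size `n₁ + ⋯ + n_k`, written in block form, commutes with
every block-diagonal matrix `diag(g₁, …, g_k)` with each `gⱼ` unitary, then it is a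
block-diagonal matrix whose `j`-th block is a scalar matrix `cⱼ · I`. -/
theorem commutant_of_block_unitaries_complex (k : ℕ) (hk : 0 < k)
    (n : Fin k → ℕ) (hn : ∀ j, 0 < n j)
    (X : Matrix (Σ j, Fin (n j)) (Σ j, Fin (n j)) ℂ)
    (hX : ∀ g : ∀ j, Matrix (Fin (n j)) (Fin (n j)) ℂ,
      (∀ j, (g j)ᴴ * g j = 1) →
        X * Matrix.blockDiagonal' g = Matrix.blockDiagonal' g * X) :
    ∃ c : Fin k → ℂ,
      X = Matrix.blockDiagonal' fun j => c j • (1 : Matrix (Fin (n j)) (Fin (n j)) ℂ) := by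
  have hoff : ∀ p q, p ≠ q → X p q = 0 := by
    intro p q hpq
    let d : ∀ j, Fin (n j) → ℂ := fun j a => if (⟨j, a⟩ : Σ j, Fin (n j)) = q then -1 else 1
    have h := hX (fun j => diagonal (d j)) fun j => by
      rw [diagonal_conjTranspose, diagonal_mul_diagonal, ← diagonal_one]
      congr 1
      funext a
      by_cases ha : (⟨j, a⟩ : Σ j, Fin (n j)) = q <;> simp [d, ha]
    have h' := congrFun₂ h p q
    rw [blockDiagonal'_diagonal, mul_diagonal, diagonal_mul] at h'
    simp only [d, Sigma.eta, if_pos, if_neg hpq] at h'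
    linear_combination -h' / 2
  have hdiag : X = diagonal fun p => X p p := by
    ext p q
    by_cases hpq : p = q
    · simp [hpq]
    · rw [hoff p q hpq, diagonal_apply_ne _ hpq]
  have hconst : ∀ j a b, X ⟨j, a⟩ ⟨j, a⟩ = X ⟨j, b⟩ ⟨j, b⟩ := by
    intro j a b
    let σ : ∀ i, Equiv.Perm (Fin (n i)) := Function.update 1 j (Equiv.swap a b)
    have h := hX (fun i => (σ i).permMatrix ℂ) fun i => by
      rw [conjTranspose_permMatrix, ← permMatrix_mul]
      simp
    rw [hdiag] at h
    have h' := congrFun₂ h ⟨j, a⟩ ⟨j, b⟩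
    rw [mul_diagonal, diagonal_mul, blockDiagonal'_apply_eq] at h'
    simpa [σ, Equiv.Perm.permMatrix, PEquiv.toMatrix_apply] using h'
  refine ⟨fun j => X ⟨j, ⟨0, hn j⟩⟩ ⟨j, ⟨0, hn j⟩⟩, ?_⟩
  simp only [smul_one_eq_diagonal, blockDiagonal'_diagonal]
  rw [hdiag]
  congr 1
  funext p
  simpa using hconst p.1 p.2 ⟨0, hn p.1⟩
end

section
/- Let n₁,…,n_k be positive integers and let X be a real square matrix of size n₁+⋯+n_k, written in block form with blocks of sizes nⱼ × n_l. If X commutes with every block-diagonal matrix diag(g₁,…,g_k) in which each gⱼ is an orthogonal nⱼ×nⱼ matrix, then there exist real scalars c₁,…,c_k such that X = diag(c₁·I_{n₁},…,c_k·I_{n_k}), the block-diagonal matrix whose j-th block is the scalar matrix c_j·I_{n_j}. -/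
open Matrix

/-- A matrix commuting with every block-diagonal orthogonal matrix is diagonal: it commutes with
the reflections in the coordinate hyperplanes. -/
theorem eq_diagonal_of_commute_block_orthogonals {ι : Type*} [Fintype ι] [DecidableEq ι]
    {m : ι → Type*} [∀ j, Fintype (m j)] [∀ j, DecidableEq (m j)]
    (X : Matrix (Σ j, m j) (Σ j, m j) ℝ)
    (hX : ∀ g : ∀ j, Matrix (m j) (m j) ℝ, (∀ j, (g j)ᵀ * g j = 1) →
      X * blockDiagonal' g = blockDiagonal' g * X) :
    X = diagonal fun p => X p p := by
  ext p q
  by_cases hpq : p = q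
  · simp [hpq]
  rw [diagonal_apply_ne _ hpq]
  let s : (Σ j, m j) → ℝ := fun r => if r = p then -1 else 1
  have hs : ∀ r, s r * s r = 1 := fun r => by by_cases h : r = p <;> simp [s, h]
  have h := hX (fun j => diagonal fun a => s ⟨j, a⟩) fun j => by
    simp [diagonal_transpose, diagonal_mul_diagonal, hs]
  have h' := congrFun (congrFun h p) q
  rw [blockDiagonal'_diagonal, mul_diagonal, diagonal_mul] at h'
  simp only [Sigma.eta, s, if_neg (Ne.symm hpq), if_true] at h'
  linarith

/-- The diagonal entries within a block of a matrix commuting with every block-diagonal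
orthogonal matrix agree: the matrix commutes with the permutations of that block. -/
theorem diag_eq_of_commute_block_orthogonals {ι : Type*} [Fintype ι] [DecidableEq ι]
    {m : ι → Type*} [∀ j, Fintype (m j)] [∀ j, DecidableEq (m j)]
    (X : Matrix (Σ j, m j) (Σ j, m j) ℝ)
    (hX : ∀ g : ∀ j, Matrix (m j) (m j) ℝ, (∀ j, (g j)ᵀ * g j = 1) →
      X * blockDiagonal' g = blockDiagonal' g * X) (j : ι) (a b : m j) :
    X ⟨j, a⟩ ⟨j, a⟩ = X ⟨j, b⟩ ⟨j, b⟩ := by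
  let σ : ∀ l, Equiv.Perm (m l) := Function.update (fun _ => 1) j (Equiv.swap a b)
  have h := hX (fun l => (σ l).permMatrix ℝ) fun l => by
    rw [transpose_permMatrix, ← permMatrix_mul]; simp
  have h' := congrFun (congrFun h ⟨j, a⟩) ⟨j, b⟩
  rw [eq_diagonal_of_commute_block_orthogonals X hX, mul_diagonal, diagonal_mul,
    blockDiagonal'_apply_eq] at h'
  simpa [σ, Equiv.Perm.permMatrix, PEquiv.toMatrix_apply] using h'

/-- If a real square matrix of size `n₁ + ⋯ + n_k`, written in block form, commutes with
every block-diagonal matrix `diag(g₁, …, g_k)` with each `gⱼ` orthogonal, then it is a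
block-diagonal matrix whose `j`-th block is a scalar matrix `cⱼ · I`. -/
theorem commutant_of_block_orthogonals_real (k : ℕ) (hk : 0 < k)
    (n : Fin k → ℕ) (hn : ∀ j, 0 < n j)
    (X : Matrix (Σ j, Fin (n j)) (Σ j, Fin (n j)) ℝ)
    (hX : ∀ g : ∀ j, Matrix (Fin (n j)) (Fin (n j)) ℝ,
      (∀ j, (g j)ᵀ * g j = 1) →
        X * Matrix.blockDiagonal' g = Matrix.blockDiagonal' g * X) :
    ∃ c : Fin k → ℝ,
      X = Matrix.blockDiagonal' fun j => c j • (1 : Matrix (Fin (n j)) (Fin (n j)) ℝ) := by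
  refine ⟨fun j => X ⟨j, ⟨0, hn j⟩⟩ ⟨j, ⟨0, hn j⟩⟩, ?_⟩
  simp only [smul_one_eq_diagonal]
  rw [blockDiagonal'_diagonal]
  refine (eq_diagonal_of_commute_block_orthogonals X hX).trans (congrArg diagonal ?_)
  funext ⟨j, a⟩
  exact diag_eq_of_commute_block_orthogonals X hX j a _
end

section
/- For every s ≥ 2 and every n ≥ 1, the set of n-tuples (X₁,…,Xₙ) of pairwise commuting traceless real symmetric s×s matrices satisfying ‖X₁‖² + ⋯ + ‖Xₙ‖² = 1, where ‖·‖ is the Frobenius norm, is path-connected (as a subspace of the Euclidean space of n-tuples of real s×s matrices). -/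
open Matrix

section CommutingTuples

variable {ι m : Type*} [Fintype m]

/-- The tuples of pairwise commuting traceless real symmetric matrices. -/
def commutingTracelessSymmetric (ι m : Type*) [Fintype m] : Set (ι → Matrix m m ℝ) :=
  {X | (∀ i, (X i)ᵀ = X i) ∧ (∀ i, (X i).trace = 0) ∧ ∀ i j, X i * X j = X j * X i}

theorem smul_mem_commutingTracelessSymmetric {X : ι → Matrix m m ℝ}
    (hX : X ∈ commutingTracelessSymmetric ι m) (c : ℝ) :
    c • X ∈ commutingTracelessSymmetric ι m := by
  obtain ⟨h1, h2, h3⟩ := hX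
  refine ⟨fun i => ?_, fun i => ?_, fun i j => ?_⟩
  · simp [transpose_smul, h1]
  · simp [trace_smul, h2]
  · simp [h3 i j]

theorem add_mem_commutingTracelessSymmetric {X Y : ι → Matrix m m ℝ}
    (hX : X ∈ commutingTracelessSymmetric ι m) (hY : Y ∈ commutingTracelessSymmetric ι m)
    (hXY : ∀ i j, X i * Y j = Y j * X i) :
    X + Y ∈ commutingTracelessSymmetric ι m := by
  obtain ⟨h1, h2, h3⟩ := hX
  obtain ⟨k1, k2, k3⟩ := hY
  refine ⟨fun i => ?_, fun i => ?_, fun i j => ?_⟩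
  · simp [transpose_add, h1, k1]
  · simp [trace_add, h2, k2]
  · simp only [Pi.add_apply, mul_add, add_mul, h3 i j, k3 i j, hXY i j, hXY j i]
    abel

variable [DecidableEq m]

theorem exists_joint_eigenvector_notMem_span {X : ι → Matrix m m ℝ} [Nontrivial m]
    (hsymm : ∀ i, (X i)ᵀ = X i) (hcomm : ∀ i j, X i * X j = X j * X i) (u : m → ℝ) :
    ∃ w : m → ℝ, (∀ i, ∃ c : ℝ, X i *ᵥ w = c • w) ∧ ∀ a : ℝ, a • u ≠ w := by
  by_contra! hcon
  have htop : ⨆ χ : ι → ℝ, ⨅ i, Module.End.eigenspace (toEuclideanLin (X i)) (χ i) = ⊤ := by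
    refine LinearMap.IsSymmetric.iSup_iInf_eq_top_of_commute (fun i => ?_) fun i j _ => ?_
    · rw [isSymmetric_toEuclideanLin_iff, IsHermitian, conjTranspose_eq_transpose_of_trivial,
        hsymm]
    · ext v : 1
      simp [toLpLin_apply, hcomm i j]
  have hle : (⊤ : Submodule ℝ (EuclideanSpace ℝ m)) ≤ Submodule.span ℝ {WithLp.toLp 2 u} := by
    rw [← htop]
    refine iSup_le fun χ v hv => ?_
    simp only [Submodule.mem_iInf, Module.End.mem_eigenspace_iff] at hv
    obtain ⟨a, ha⟩ := hcon v.ofLp fun i => ⟨χ i, by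
      have := congrArg WithLp.ofLp (hv i)
      simpa [toLpLin_apply] using this⟩
    refine Submodule.mem_span_singleton.2 ⟨a, ?_⟩
    rw [← WithLp.toLp_smul, ha]
  have h1 := Submodule.finrank_mono hle
  have h2 := finrank_span_le_card (R := ℝ) ({WithLp.toLp 2 u} : Set (EuclideanSpace ℝ m))
  have h3 := Fintype.one_lt_card (α := m)
  simp only [finrank_top, finrank_euclideanSpace, Set.toFinset_singleton,
    Finset.card_singleton] at h1 h2
  omega

/-- The traceless part of the rank-one matrix `v vᵀ`. -/
noncomputable def tracelessRankOne (v : m → ℝ) : Matrix m m ℝ :=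
  vecMulVec v v - ((v ⬝ᵥ v) / Fintype.card m) • (1 : Matrix m m ℝ)

theorem continuous_tracelessRankOne : Continuous (tracelessRankOne : (m → ℝ) → Matrix m m ℝ) := by
  unfold tracelessRankOne
  fun_prop

theorem tracelessRankOne_mulVec (v w : m → ℝ) :
    tracelessRankOne v *ᵥ w = (v ⬝ᵥ w) • v - ((v ⬝ᵥ v) / Fintype.card m) • w := by
  simp [tracelessRankOne, sub_mulVec, vecMulVec_mulVec, smul_mulVec]

theorem transpose_tracelessRankOne (v : m → ℝ) : (tracelessRankOne v)ᵀ = tracelessRankOne v := by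
  simp [tracelessRankOne, transpose_vecMulVec]

theorem trace_tracelessRankOne [Nonempty m] (v : m → ℝ) : (tracelessRankOne v).trace = 0 := by
  simp [tracelessRankOne, trace_vecMulVec]

theorem mul_tracelessRankOne_comm {A : Matrix m m ℝ} (hA : Aᵀ = A) {v : m → ℝ} {c : ℝ}
    (hv : A *ᵥ v = c • v) : A * tracelessRankOne v = tracelessRankOne v * A := by
  have hv' : v ᵥ* A = c • v := by rw [← hA, vecMul_transpose, hv]
  simp [tracelessRankOne, mul_sub, sub_mul, mul_vecMulVec, vecMulVec_mul, hv, hv']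

theorem eq_zero_of_smul_tracelessRankOne_eq {u w : m → ℝ} (huw : LinearIndependent ℝ ![u, w])
    {α β : ℝ} (hα : 0 ≤ α) (hβ : 0 ≤ β)
    (h : α • tracelessRankOne u = β • tracelessRankOne w) : α = 0 ∧ β = 0 := by
  have hu : 0 < u ⬝ᵥ u := by
    simpa using dotProduct_star_self_pos_iff.2 (huw.ne_zero 0)
  have hw : 0 < w ⬝ᵥ w := by
    simpa using dotProduct_star_self_pos_iff.2 (huw.ne_zero 1)
  have hpair := LinearIndependent.pair_iff.1 huw
  set k : ℝ := α * ((u ⬝ᵥ u) / Fintype.card m) - β * ((w ⬝ᵥ w) / Fintype.card m) with hk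
  have key (x : m → ℝ) : (α * (u ⬝ᵥ x)) • u - (β * (w ⬝ᵥ x)) • w = k • x := by
    have := congrArg (· *ᵥ x) h
    simp only [smul_mulVec, tracelessRankOne_mulVec, smul_sub, smul_smul] at this
    rw [hk, sub_smul]
    linear_combination (norm := module) this
  have h1 := (hpair (α * (u ⬝ᵥ u) - k) (-(β * (w ⬝ᵥ u))) (by
    linear_combination (norm := module) key u)).1
  have h2 := (hpair (α * (u ⬝ᵥ w)) (-(β * (w ⬝ᵥ w)) - k) (by
    linear_combination (norm := module) key w)).2
  have h3 := mul_nonneg hα hu.le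
  have h4 := mul_nonneg hβ hw.le
  constructor
  · exact (mul_eq_zero.1 (by linarith : α * (u ⬝ᵥ u) = 0)).resolve_right hu.ne'
  · exact (mul_eq_zero.1 (by linarith : β * (w ⬝ᵥ w) = 0)).resolve_right hw.ne'

theorem tracelessRankOne_ne_zero [Nontrivial m] {v : m → ℝ} (hv : v ≠ 0) :
    tracelessRankOne v ≠ 0 := by
  intro h
  obtain ⟨w, -, hw⟩ := exists_joint_eigenvector_notMem_span
    (X := fun _ : Unit => (0 : Matrix m m ℝ))
    (by simp) (by simp) v
  have := eq_zero_of_smul_tracelessRankOne_eq ((LinearIndependent.pair_iff' hv).2 hw)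
    zero_le_one le_rfl (by simp [h])
  exact one_ne_zero this.1

variable [DecidableEq ι]

theorem single_tracelessRankOne_mem [Nonempty m] (i₀ : ι) (v : m → ℝ) :
    Pi.single i₀ (tracelessRankOne v) ∈ commutingTracelessSymmetric ι m := by
  refine ⟨fun i => ?_, fun i => ?_, fun i j => ?_⟩
  · obtain rfl | hi := eq_or_ne i i₀ <;> simp [*, transpose_tracelessRankOne]
  · obtain rfl | hi := eq_or_ne i i₀ <;> simp [*, trace_tracelessRankOne]
  · by_cases hi : i = i₀ <;> by_cases hj : j = i₀ <;> simp [hi, hj]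

theorem segment_single_tracelessRankOne_subset [Nonempty m] (i₀ : ι) {X : ι → Matrix m m ℝ}
    (hX : X ∈ commutingTracelessSymmetric ι m) {v : m → ℝ}
    (hv : ∀ i, ∃ c : ℝ, X i *ᵥ v = c • v) :
    segment ℝ X (Pi.single i₀ (tracelessRankOne v)) ⊆ commutingTracelessSymmetric ι m := by
  rintro _ ⟨a, b, -, -, -, rfl⟩
  refine add_mem_commutingTracelessSymmetric (smul_mem_commutingTracelessSymmetric hX a)
    (smul_mem_commutingTracelessSymmetric (single_tracelessRankOne_mem i₀ v) b) fun i j => ?_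
  obtain ⟨c, hc⟩ := hv i
  obtain rfl | hj := eq_or_ne j i₀
  · simp [mul_tracelessRankOne_comm (hX.1 i) hc, smul_comm a b]
  · simp [hj]

theorem exists_joinedIn_single_tracelessRankOne [Nontrivial m] (i₀ : ι) {X : ι → Matrix m m ℝ}
    (hX : X ∈ commutingTracelessSymmetric ι m) (hX0 : X ≠ 0) :
    ∃ v : m → ℝ, v ≠ 0 ∧
      JoinedIn (commutingTracelessSymmetric ι m \ {0}) X (Pi.single i₀ (tracelessRankOne v)) := by
  obtain ⟨u, hu, hu0⟩ := exists_joint_eigenvector_notMem_span hX.1 hX.2.2 0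
  obtain ⟨w, hw, huw⟩ := exists_joint_eigenvector_notMem_span hX.1 hX.2.2 u
  replace hu0 : u ≠ 0 := by simpa using (hu0 0).symm
  have hw0 : w ≠ 0 := by simpa using (huw 0).symm
  by_contra! hcon
  have hseg {v : m → ℝ} (hv : ∀ i, ∃ c : ℝ, X i *ᵥ v = c • v) (hv0 : v ≠ 0) :
      ∃ a b : ℝ, 0 < a ∧ 0 < b ∧
        a • X + b • (Pi.single i₀ (tracelessRankOne v) : ι → Matrix m m ℝ) = 0 := by
    have hzero : 0 ∈ segment ℝ X (Pi.single i₀ (tracelessRankOne v)) := by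
      by_contra hmem
      refine hcon v hv0 (JoinedIn.of_segment_subset fun Y hY =>
        ⟨segment_single_tracelessRankOne_subset i₀ hX hv hY, ?_⟩)
      rintro rfl
      exact hmem hY
    obtain ⟨a, b, ha, hb, hab, h⟩ := hzero
    refine ⟨a, b, ha.lt_of_ne' ?_, hb.lt_of_ne' ?_, h⟩
    · rintro rfl
      obtain rfl : b = 1 := by linarith
      exact tracelessRankOne_ne_zero hv0 (by simpa using h)
    · rintro rfl
      obtain rfl : a = 1 := by linarith
      exact hX0 (by simpa using h)
  obtain ⟨a, b, ha, hb, h⟩ := hseg hu hu0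
  obtain ⟨a', b', ha', hb', h'⟩ := hseg hw hw0
  have e := congrFun h i₀
  have e' := congrFun h' i₀
  simp only [Pi.add_apply, Pi.smul_apply, Pi.single_eq_same, Pi.zero_apply] at e e'
  have := eq_zero_of_smul_tracelessRankOne_eq ((LinearIndependent.pair_iff' hu0).2 huw)
    (mul_pos ha' hb).le (mul_pos ha hb').le (by
      linear_combination (norm := module) a' • e - a • e')
  exact (mul_pos ha' hb).ne' this.1

theorem isPathConnected_commutingTracelessSymmetric_diff_zero [Nontrivial m] [Nonempty ι] :
    IsPathConnected (commutingTracelessSymmetric ι m \ {0}) := by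
  obtain ⟨i₀⟩ := ‹Nonempty ι›
  let f : (m → ℝ) → ι → Matrix m m ℝ := fun v => Pi.single i₀ (tracelessRankOne v)
  have hf : Continuous f := (continuous_single i₀).comp continuous_tracelessRankOne
  have hrank : 1 < Module.rank ℝ (m → ℝ) := by
    rw [rank_fun']
    exact_mod_cast Fintype.one_lt_card (α := m)
  have himage : IsPathConnected (f '' {0}ᶜ) :=
    (isPathConnected_compl_singleton_of_one_lt_rank hrank 0).image hf
  have hsub : f '' {0}ᶜ ⊆ commutingTracelessSymmetric ι m \ {0} := by
    rintro _ ⟨v, hv, rfl⟩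
    exact ⟨single_tracelessRankOne_mem i₀ v, by simpa [f] using tracelessRankOne_ne_zero hv⟩
  obtain ⟨Y, hY, hYjoin⟩ := himage
  refine ⟨Y, hsub hY, fun {X} hX => ?_⟩
  obtain ⟨v, hv, hjoin⟩ := exists_joinedIn_single_tracelessRankOne i₀ hX.1 hX.2
  exact ((hYjoin ⟨v, hv, rfl⟩).mono hsub).trans hjoin.symm

end CommutingTuples

/-- For `s ≥ 2` and `n ≥ 1`, the space of `n`-tuples of pairwise commuting traceless real
symmetric `s × s` matrices of total Frobenius norm one is path-connected. -/
theorem unit_sphere_commuting_traceless_symmetric_pathConnected (s n : ℕ)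
    (hs : 2 ≤ s) (hn : 1 ≤ n) :
    IsPathConnected {X : Fin n → Matrix (Fin s) (Fin s) ℝ |
      (∀ i, (X i)ᵀ = X i) ∧ (∀ i, (X i).trace = 0) ∧
      (∀ i j, X i * X j = X j * X i) ∧
      ∑ i, ∑ a, ∑ b, (X i a b) ^ 2 = 1} := by
  have : Nontrivial (Fin s) := Fin.nontrivial_iff_two_le.2 hs
  have : Nonempty (Fin n) := ⟨⟨0, hn⟩⟩
  let q : (Fin n → Matrix (Fin s) (Fin s) ℝ) → ℝ := fun X => ∑ i, ∑ a, ∑ b, (X i a b) ^ 2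
  have hq : Continuous q := by fun_prop
  have hq_smul (c : ℝ) (X) : q (c • X) = c ^ 2 * q X := by
    simp [q, mul_pow, Finset.mul_sum]
  have hq_pos {X} (hX : X ≠ 0) : 0 < q X := by
    refine lt_of_le_of_ne (by positivity) fun h => hX ?_
    ext i a b
    have h1 := (Finset.sum_eq_zero_iff_of_nonneg fun i _ => by positivity).1 h.symm i
      (Finset.mem_univ i)
    have h2 := (Finset.sum_eq_zero_iff_of_nonneg fun a _ => by positivity).1 h1 a
      (Finset.mem_univ a)
    have h3 := (Finset.sum_eq_zero_iff_of_nonneg fun b _ => by positivity).1 h2 b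
      (Finset.mem_univ b)
    simpa using h3
  have hcont : ContinuousOn (fun X => (√(q X))⁻¹ • X)
      (commutingTracelessSymmetric (Fin n) (Fin s) \ {0}) := by
    refine ContinuousOn.smul (hq.sqrt.continuousOn.inv₀ fun X hX => ?_) continuousOn_id
    exact (Real.sqrt_pos.2 (hq_pos hX.2)).ne'
  convert isPathConnected_commutingTracelessSymmetric_diff_zero.image' hcont using 1
  ext X
  constructor
  · rintro ⟨h1, h2, h3, h4⟩
    have h4' : q X = 1 := h4
    refine ⟨X, ⟨⟨h1, h2, h3⟩, ?_⟩, by simp [h4']⟩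
    rintro rfl
    simp [q] at h4'
  · rintro ⟨Y, ⟨hY, hY0⟩, rfl⟩
    obtain ⟨h1, h2, h3⟩ := smul_mem_commutingTracelessSymmetric hY (√(q Y))⁻¹
    refine ⟨h1, h2, h3, ?_⟩
    have hpos := hq_pos hY0
    change q _ = 1
    rw [hq_smul, inv_pow, Real.sq_sqrt hpos.le, inv_mul_cancel₀ hpos.ne']
end
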